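/- There is a constant C > 0 (depending only on the dyadic partition) such that for every smooth divergence-free vector field u = (u¹,u²) : 𝕋² → ℝ², every smooth vector field w : 𝕋² → ℝ², and every integer k ≥ −1, one has |⟨S^v_{k−1}u² · Δ^v_k∂₂w, Δ^v_k w⟩_{L²}| ≤ C ‖S^v_{k−1}∂₁u¹‖_{L^∞_v(L²_h)} ‖Δ^v_k w‖²_{L²_v(L⁴_h)}. -/

import Mathlib

open MeasureTheory Real Complex Filter Set

noncomputable section

namespace Aniso

/-- Fundamental domain `(0, 2π]` for the circle of circumference `2π`. -/
def I2pi : Set ℝ := Set.Ioc 0 (2 * π)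

/-- Fundamental domain for the 2-torus `𝕋² = (ℝ/2πℤ)²`. -/
def Q2 : Set (ℝ × ℝ) := I2pi ×ˢ I2pi

/-- Integral over the torus of a real function. -/
def tintR (f : ℝ × ℝ → ℝ) : ℝ := ∫ x in Q2, f x

/-- Smoothness of a scalar field. -/
def Smooth (f : ℝ × ℝ → ℝ) : Prop := ContDiff ℝ (⊤ : ℕ∞) f

/-- Smoothness of a vector field. -/
def SmoothV (u : ℝ × ℝ → ℝ × ℝ) : Prop := ContDiff ℝ (⊤ : ℕ∞) u

/-- `2π`-periodicity in each variable: this encodes being a function on the torus. -/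
def Per (f : ℝ × ℝ → ℝ) : Prop :=
  (∀ x : ℝ × ℝ, f (x.1 + 2 * π, x.2) = f x) ∧ (∀ x : ℝ × ℝ, f (x.1, x.2 + 2 * π) = f x)

def PerV (u : ℝ × ℝ → ℝ × ℝ) : Prop :=
  Per (fun x => (u x).1) ∧ Per (fun x => (u x).2)

/-- Partial derivative in the horizontal variable `x₁`. -/
def pd1 (f : ℝ × ℝ → ℝ) : ℝ × ℝ → ℝ := fun x => fderiv ℝ f x (1, 0)

/-- Partial derivative in the vertical variable `x₂`. -/
def pd2 (f : ℝ × ℝ → ℝ) : ℝ × ℝ → ℝ := fun x => fderiv ℝ f x (0, 1)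

def comp1 (u : ℝ × ℝ → ℝ × ℝ) : ℝ × ℝ → ℝ := fun x => (u x).1
def comp2 (u : ℝ × ℝ → ℝ × ℝ) : ℝ × ℝ → ℝ := fun x => (u x).2

def pd1V (u : ℝ × ℝ → ℝ × ℝ) : ℝ × ℝ → ℝ × ℝ := fun x => (pd1 (comp1 u) x, pd1 (comp2 u) x)
def pd2V (u : ℝ × ℝ → ℝ × ℝ) : ℝ × ℝ → ℝ × ℝ := fun x => (pd2 (comp1 u) x, pd2 (comp2 u) x)

/-- Divergence-free condition `∂₁u¹ + ∂₂u² = 0`. -/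
def DivFree (u : ℝ × ℝ → ℝ × ℝ) : Prop :=
  ∀ x, pd1 (comp1 u) x + pd2 (comp2 u) x = 0

/-- The transport term `u·∇v`, with components `u¹∂₁vʲ + u²∂₂vʲ`. -/
def advect (u v : ℝ × ℝ → ℝ × ℝ) : ℝ × ℝ → ℝ × ℝ := fun x =>
  ((u x).1 * pd1 (comp1 v) x + (u x).2 * pd2 (comp1 v) x,
   (u x).1 * pd1 (comp2 v) x + (u x).2 * pd2 (comp2 v) x)

/-- L² inner product of real vector fields on the torus (summed over components). -/
def ipV (u v : ℝ × ℝ → ℝ × ℝ) : ℝ := tintR fun x => (u x).1 * (v x).1 + (u x).2 * (v x).2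

/-- The trilinear form `b(u,v,w) = ∫ (u·∇v)·w`. -/
def b3 (u v w : ℝ × ℝ → ℝ × ℝ) : ℝ := ipV (advect u v) w

/-- L² norm of a scalar function on the torus. -/
def L2 (f : ℝ × ℝ → ℝ) : ℝ := Real.sqrt (tintR fun x => f x ^ 2)

/-- L² norm of a vector field on the torus. -/
def L2V (u : ℝ × ℝ → ℝ × ℝ) : ℝ := Real.sqrt (tintR fun x => (u x).1 ^ 2 + (u x).2 ^ 2)

/-- Fourier coefficient of a complex-valued function on the torus. -/
def fcC (f : ℝ × ℝ → ℂ) (k : ℤ × ℤ) : ℂ :=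
  (1 / (2 * π) ^ 2 : ℂ) *
    ∫ x in Q2, f x * Complex.exp (-(Complex.I) * ((k.1 : ℂ) * (x.1 : ℂ) + (k.2 : ℂ) * (x.2 : ℂ)))

/-- Fourier coefficient of a real-valued function on the torus. -/
def fc (f : ℝ × ℝ → ℝ) (k : ℤ × ℤ) : ℂ := fcC (fun x => (f x : ℂ)) k

/-- Anisotropic Sobolev weight `(1+|k₁|²)^s (1+|k₂|²)^{s'}`. -/
def aw (s s' : ℝ) (k : ℤ × ℤ) : ℝ :=
  (1 + (k.1 : ℝ) ^ 2) ^ s * (1 + (k.2 : ℝ) ^ 2) ^ s'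

/-- Square of the anisotropic Sobolev norm `H^{s,s'}` of a scalar function. -/
def HSq (s s' : ℝ) (f : ℝ × ℝ → ℝ) : ℝ := ∑' k : ℤ × ℤ, aw s s' k * ‖fc f k‖ ^ 2

/-- Anisotropic Sobolev norm `H^{s,s'}` of a scalar function. -/
def HN (s s' : ℝ) (f : ℝ × ℝ → ℝ) : ℝ := Real.sqrt (HSq s s' f)

/-- Anisotropic Sobolev norm `H^{s,s'}` of a vector field. -/
def HNV (s s' : ℝ) (u : ℝ × ℝ → ℝ × ℝ) : ℝ :=
  Real.sqrt (HSq s s' (comp1 u) + HSq s s' (comp2 u))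

/-- Mixed norm `L^∞_h(L²_v)`. -/
def LinfhL2v (f : ℝ × ℝ → ℝ) : ℝ :=
  essSup (fun x1 : ℝ => Real.sqrt (∫ x2 in I2pi, f (x1, x2) ^ 2)) (volume.restrict I2pi)

/-- Mixed norm `L²_h(L^∞_v)`. -/
def L2hLinfv (f : ℝ × ℝ → ℝ) : ℝ :=
  Real.sqrt (∫ x1 in I2pi, (essSup (fun x2 : ℝ => |f (x1, x2)|) (volume.restrict I2pi)) ^ 2)

/-- Mixed norm `L²_v(L^{4/3}_h)`. -/
def L2vL43h {E : Type*} [NormedAddCommGroup E] (f : ℝ × ℝ → E) : ℝ :=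
  Real.sqrt (∫ x2 in I2pi, (∫ x1 in I2pi, ‖f (x1, x2)‖ ^ ((4 : ℝ)/3)) ^ ((3 : ℝ)/2))

/-- Mixed norm `L^∞_v(L²_h)`. -/
def LinfvL2h {E : Type*} [NormedAddCommGroup E] (f : ℝ × ℝ → E) : ℝ :=
  essSup (fun x2 : ℝ => Real.sqrt (∫ x1 in I2pi, ‖f (x1, x2)‖ ^ 2)) (volume.restrict I2pi)

/-- Mixed norm `L²_v(L⁴_h)`. -/
def L2vL4h {E : Type*} [NormedAddCommGroup E] (f : ℝ × ℝ → E) : ℝ :=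
  Real.sqrt (∫ x2 in I2pi, Real.sqrt (∫ x1 in I2pi, ‖f (x1, x2)‖ ^ 4))

/-- One-dimensional Fourier coefficient on the circle of circumference `2π`. -/
def fc1 (g : ℝ → ℂ) (n : ℤ) : ℂ :=
  (1 / (2 * π) : ℂ) * ∫ x in I2pi, g x * Complex.exp (-(Complex.I) * ((n : ℂ) * (x : ℂ)))

/-- Square of the 1-d Sobolev norm `H^s(𝕋)`. -/
def H1Sq (s : ℝ) (g : ℝ → ℂ) : ℝ := ∑' n : ℤ, (1 + (n : ℝ) ^ 2) ^ s * ‖fc1 g n‖ ^ 2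

/-- Mixed norm `L²_v(H^s_h)`. -/
def L2vHsh (s : ℝ) (f : ℝ × ℝ → ℂ) : ℝ :=
  Real.sqrt (∫ x2 in I2pi, H1Sq s (fun x1 => f (x1, x2)))

/-- A dyadic partition of unity `(χ, θ)` on `ℝ`. -/
structure IsDyadicPartition (χ θ : ℝ → ℝ) : Prop where
  smooth_chi : ContDiff ℝ (⊤ : ℕ∞) χ
  smooth_theta : ContDiff ℝ (⊤ : ℕ∞) θ
  nonneg_chi : ∀ z, 0 ≤ χ z
  nonneg_theta : ∀ z, 0 ≤ θ z
  even_chi : ∀ z, χ (-z) = χ z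
  even_theta : ∀ z, θ (-z) = θ z
  chi_support : ∃ R > 0, ∀ z, R ≤ |z| → χ z = 0
  theta_support : ∃ r R : ℝ, 0 < r ∧ r < R ∧ ∀ z, (|z| < r ∨ R < |z|) → θ z = 0
  partition : ∀ z : ℝ, χ z + ∑' j : ℕ, θ ((2 : ℝ) ^ (-(j : ℤ)) * z) = 1
  chi_theta_disj : ∀ j : ℕ, 1 ≤ j → ∀ z, χ z * θ ((2 : ℝ) ^ (-(j : ℤ)) * z) = 0
  theta_theta_disj : ∀ i j : ℕ, 1 < |(i : ℤ) - (j : ℤ)| → ∀ z,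
    θ ((2 : ℝ) ^ (-(i : ℤ)) * z) * θ ((2 : ℝ) ^ (-(j : ℤ)) * z) = 0

/-- The Fourier multiplier symbol of the vertical Littlewood–Paley block `Δ^v_j`. -/
def blockSymb (χ θ : ℝ → ℝ) (j : ℤ) (z : ℝ) : ℝ :=
  if j = -1 then χ |z| else if 0 ≤ j then θ ((2 : ℝ) ^ (-j) * |z|) else 0

/-- The Fourier multiplier symbol of the vertical low-frequency cut-off `S^v_j`. -/
def lowSymb (χ θ : ℝ → ℝ) (j : ℤ) (z : ℝ) : ℝ :=
  ∑ j' ∈ Finset.Icc (-1 : ℤ) (j - 2), blockSymb χ θ j' z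

/-- The character `e^{ik·x}`. -/
def eK (k : ℤ × ℤ) (x : ℝ × ℝ) : ℂ :=
  Complex.exp (Complex.I * ((k.1 : ℂ) * (x.1 : ℂ) + (k.2 : ℂ) * (x.2 : ℂ)))

/-- Vertical Littlewood–Paley block `Δ^v_j` of a complex-valued function. -/
def LPC (χ θ : ℝ → ℝ) (j : ℤ) (f : ℝ × ℝ → ℂ) : ℝ × ℝ → ℂ :=
  fun x => ∑' k : ℤ × ℤ, (blockSymb χ θ j k.2 : ℂ) * fcC f k * eK k x

/-- Vertical Littlewood–Paley block `Δ^v_j` of a real-valued function. -/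
def LP (χ θ : ℝ → ℝ) (j : ℤ) (f : ℝ × ℝ → ℝ) : ℝ × ℝ → ℂ :=
  LPC χ θ j fun x => (f x : ℂ)

/-- Vertical low-frequency cut-off `S^v_j` of a complex-valued function. -/
def SvC (χ θ : ℝ → ℝ) (j : ℤ) (f : ℝ × ℝ → ℂ) : ℝ × ℝ → ℂ :=
  fun x => ∑' k : ℤ × ℤ, (lowSymb χ θ j k.2 : ℂ) * fcC f k * eK k x

/-- Vertical low-frequency cut-off `S^v_j` of a real-valued function. -/
def Sv (χ θ : ℝ → ℝ) (j : ℤ) (f : ℝ × ℝ → ℝ) : ℝ × ℝ → ℂ :=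
  SvC χ θ j fun x => (f x : ℂ)

/-- Componentwise Littlewood–Paley block of a vector field. -/
def LPV (χ θ : ℝ → ℝ) (j : ℤ) (u : ℝ × ℝ → ℝ × ℝ) : ℝ × ℝ → ℂ × ℂ :=
  fun x => (LP χ θ j (comp1 u) x, LP χ θ j (comp2 u) x)

/-- Componentwise low-frequency cut-off of a vector field. -/
def SvV (χ θ : ℝ → ℝ) (j : ℤ) (u : ℝ × ℝ → ℝ × ℝ) : ℝ × ℝ → ℂ × ℂ :=
  fun x => (Sv χ θ j (comp1 u) x, Sv χ θ j (comp2 u) x)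

/-- L² inner product of complex-valued functions on the torus. -/
def ipC (f g : ℝ × ℝ → ℂ) : ℂ := ∫ x in Q2, f x * (starRingEnd ℂ) (g x)

/-- L² inner product of complex vector fields on the torus (summed over components). -/
def ipCV (f g : ℝ × ℝ → ℂ × ℂ) : ℂ :=
  ∫ x in Q2, ((f x).1 * (starRingEnd ℂ) ((g x).1) + (f x).2 * (starRingEnd ℂ) ((g x).2))

/-- The vertical paraproduct `T^v_a g = Σ_j S^v_{j-1}a · Δ^v_j g`. -/
def Tv (χ θ : ℝ → ℝ) (a g : ℝ × ℝ → ℝ) : ℝ × ℝ → ℂ :=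
  fun x => ∑' j : ℤ, Sv χ θ (j - 1) a x * LP χ θ j g x

/-- The vertical remainder `R^v(a,g) = Σ_{|j-j'|≤1} Δ^v_j a · Δ^v_{j'} g`. -/
def Rv (χ θ : ℝ → ℝ) (a g : ℝ × ℝ → ℝ) : ℝ × ℝ → ℂ :=
  fun x => ∑' p : ℤ × ℤ, if |p.1 - p.2| ≤ 1 then LP χ θ p.1 a x * LP χ θ p.2 g x else 0


theorem integrableOn_Q2 {E : Type*} [NormedAddCommGroup E] {f : ℝ × ℝ → E} (hf : Continuous f) :
    IntegrableOn f Q2 :=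
  (hf.continuousOn.integrableOn_compact (isCompact_Icc.prod isCompact_Icc)).mono_set
    (Set.prod_mono Ioc_subset_Icc_self Ioc_subset_Icc_self)

theorem setIntegral_Q2 {E : Type*} [NormedAddCommGroup E] [NormedSpace ℝ E]
    {f : ℝ × ℝ → E} (hf : Continuous f) :
    ∫ x in Q2, f x = ∫ x in I2pi, ∫ y in I2pi, f (x, y) :=
  setIntegral_prod f (integrableOn_Q2 hf)

theorem setIntegral_Q2_swap {E : Type*} [NormedAddCommGroup E] [NormedSpace ℝ E]
    {f : ℝ × ℝ → E} (hf : Continuous f) :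
    ∫ x in Q2, f x = ∫ y in I2pi, ∫ x in I2pi, f (x, y) := by
  rw [← setIntegral_Q2 (f := fun z => f (z.2, z.1)) (by fun_prop)]
  exact (setIntegral_prod_swap I2pi I2pi f).symm

theorem integral_I2pi_deriv_eq_zero {G G' : ℝ → ℂ} (h : ∀ y, HasDerivAt G (G' y) y)
    (hc : Continuous G') (hper : G (2 * π) = G 0) : ∫ y in I2pi, G' y = 0 := by
  rw [I2pi, ← intervalIntegral.integral_of_le (by positivity),
    intervalIntegral.integral_eq_sub_of_hasDerivAt (fun y _ => h y) (hc.intervalIntegrable _ _),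
    hper, sub_self]

theorem integral_Q2_deriv_fst_eq_zero {G G' : ℝ × ℝ → ℂ}
    (h : ∀ x y, HasDerivAt (fun s => G (s, y)) (G' (x, y)) x) (hc : Continuous G')
    (hper : ∀ y, G (2 * π, y) = G (0, y)) : ∫ x in Q2, G' x = 0 := by
  rw [setIntegral_Q2_swap hc]
  simp_rw [fun y => integral_I2pi_deriv_eq_zero (fun x => h x y)
    (hc.comp (Continuous.prodMk_left y)) (hper y)]
  simp

theorem integral_Q2_deriv_snd_eq_zero {G G' : ℝ × ℝ → ℂ}
    (h : ∀ x y, HasDerivAt (fun s => G (x, s)) (G' (x, y)) y) (hc : Continuous G')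
    (hper : ∀ x, G (x, 2 * π) = G (x, 0)) : ∫ x in Q2, G' x = 0 := by
  rw [setIntegral_Q2 hc]
  simp_rw [fun x => integral_I2pi_deriv_eq_zero (fun y => h x y)
    (hc.comp (Continuous.prodMk_right x)) (hper x)]
  simp

theorem continuous_eK (k : ℤ × ℤ) : Continuous (eK k) := by
  unfold eK; fun_prop

theorem norm_eK (k : ℤ × ℤ) (x : ℝ × ℝ) : ‖eK k x‖ = 1 := by
  have : eK k x = Complex.exp (((k.1 * x.1 + k.2 * x.2 : ℝ) : ℂ) * Complex.I) := by
    unfold eK; push_cast; ring_nf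
  rw [this, Complex.norm_exp_ofReal_mul_I]

theorem conj_eK (k : ℤ × ℤ) (x : ℝ × ℝ) : (starRingEnd ℂ) (eK k x) = eK (-k) x := by
  unfold eK
  rw [← Complex.exp_conj]
  simp
  ring_nf

theorem hasDerivAt_eK_fst (k : ℤ × ℤ) (x y : ℝ) :
    HasDerivAt (fun s : ℝ => eK k (s, y)) (Complex.I * k.1 * eK k (x, y)) x := by
  have h : HasDerivAt (fun s : ℝ => Complex.I * ((k.1 : ℂ) * (s : ℂ) + (k.2 : ℂ) * (y : ℂ)))
      (Complex.I * ((k.1 : ℂ) * 1)) x :=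
    (((Complex.ofRealCLM.hasDerivAt (x := x)).const_mul (k.1 : ℂ)).add_const _).const_mul _
  exact h.cexp.congr_deriv (by simp only [eK]; ring)

theorem hasDerivAt_eK_snd (k : ℤ × ℤ) (x y : ℝ) :
    HasDerivAt (fun s : ℝ => eK k (x, s)) (Complex.I * k.2 * eK k (x, y)) y := by
  have h : HasDerivAt (fun s : ℝ => Complex.I * ((k.1 : ℂ) * (x : ℂ) + (k.2 : ℂ) * (s : ℂ)))
      (Complex.I * ((k.2 : ℂ) * 1)) y :=
    (((Complex.ofRealCLM.hasDerivAt (x := y)).const_mul (k.2 : ℂ)).const_add _).const_mul _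
  exact h.cexp.congr_deriv (by simp only [eK]; ring)

theorem eK_two_pi_fst (k : ℤ × ℤ) (y : ℝ) : eK k (2 * π, y) = eK k (0, y) := by
  unfold eK
  refine Complex.exp_eq_exp_iff_exists_int.2 ⟨k.1, ?_⟩
  push_cast; ring

theorem eK_two_pi_snd (k : ℤ × ℤ) (x : ℝ) : eK k (x, 2 * π) = eK k (x, 0) := by
  unfold eK
  refine Complex.exp_eq_exp_iff_exists_int.2 ⟨k.2, ?_⟩
  push_cast; ring

theorem fc_eq (f : ℝ × ℝ → ℝ) (k : ℤ × ℤ) :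
    fc f k = (1 / (2 * π) ^ 2 : ℂ) * ∫ x in Q2, (f x : ℂ) * eK (-k) x := by
  unfold fc fcC eK
  congr 2
  ext x
  congr 2
  simp
  ring

theorem Smooth.pd1 {f : ℝ × ℝ → ℝ} (hf : Smooth f) : Smooth (pd1 f) := by
  unfold Smooth Aniso.pd1 at *
  exact (hf.fderiv_right (by simp)).clm_apply contDiff_const

theorem Smooth.pd2 {f : ℝ × ℝ → ℝ} (hf : Smooth f) : Smooth (pd2 f) := by
  unfold Smooth Aniso.pd2 at *
  exact (hf.fderiv_right (by simp)).clm_apply contDiff_const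

theorem fderiv_of_periodic {f : ℝ × ℝ → ℝ} {a : ℝ × ℝ} (h : ∀ x, f (x + a) = f x)
    (x : ℝ × ℝ) : fderiv ℝ f (x + a) = fderiv ℝ f x := by
  rw [← fderiv_comp_add_right]
  simp_rw [h]

theorem Per.fderiv {f : ℝ × ℝ → ℝ} (hf : Per f) (v : ℝ × ℝ) :
    Per (fun x => fderiv ℝ f x v) := by
  have h1 : ∀ x, f (x + (2 * π, 0)) = f x := fun x => by
    rw [← hf.1 x]; congr 1; ext <;> simp
  have h2 : ∀ x, f (x + (0, 2 * π)) = f x := fun x => by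
    rw [← hf.2 x]; congr 1; ext <;> simp
  refine ⟨fun x => ?_, fun x => ?_⟩
  · simp only; rw [← fderiv_of_periodic h1 x]; congr 2; ext <;> simp
  · simp only; rw [← fderiv_of_periodic h2 x]; congr 2; ext <;> simp

theorem Smooth.hasDerivAt_fst {f : ℝ × ℝ → ℝ} (hf : Smooth f) (x y : ℝ) :
    HasDerivAt (fun s => f (s, y)) (Aniso.pd1 f (x, y)) x :=
  ((hf.differentiable (by simp)) (x, y)).hasFDerivAt.comp_hasDerivAt x
    ((hasDerivAt_id x).prodMk (hasDerivAt_const x y))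

theorem Smooth.hasDerivAt_snd {f : ℝ × ℝ → ℝ} (hf : Smooth f) (x y : ℝ) :
    HasDerivAt (fun s => f (x, s)) (Aniso.pd2 f (x, y)) y :=
  ((hf.differentiable (by simp)) (x, y)).hasFDerivAt.comp_hasDerivAt y
    ((hasDerivAt_const y x).prodMk (hasDerivAt_id y))

theorem fc_pd1 {f : ℝ × ℝ → ℝ} (hf : Smooth f) (hp : Per f) (k : ℤ × ℤ) :
    fc (pd1 f) k = Complex.I * k.1 * fc f k := by
  have hc := hf.continuous
  have hc1 := hf.pd1.continuous
  have he := continuous_eK (-k)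
  have h0 := integral_Q2_deriv_fst_eq_zero (G := fun x => (f x : ℂ) * eK (-k) x)
    (G' := fun x => (pd1 f x : ℂ) * eK (-k) x - Complex.I * k.1 * ((f x : ℂ) * eK (-k) x))
    (fun x y => by
      refine ((hf.hasDerivAt_fst x y).ofReal_comp.mul (hasDerivAt_eK_fst (-k) x y)).congr_deriv ?_
      simp only [Prod.fst_neg, Int.cast_neg]; ring)
    (by fun_prop)
    (fun y => by
      have := hp.1 (0, y)
      simp only [zero_add] at this
      simp only [eK_two_pi_fst, this])
  rw [integral_sub (integrableOn_Q2 (by fun_prop)) (integrableOn_Q2 (by fun_prop)),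
    integral_const_mul, sub_eq_zero] at h0
  rw [fc_eq, fc_eq, h0]; ring

theorem fc_pd2 {f : ℝ × ℝ → ℝ} (hf : Smooth f) (hp : Per f) (k : ℤ × ℤ) :
    fc (pd2 f) k = Complex.I * k.2 * fc f k := by
  have hc := hf.continuous
  have hc2 := hf.pd2.continuous
  have he := continuous_eK (-k)
  have h0 := integral_Q2_deriv_snd_eq_zero (G := fun x => (f x : ℂ) * eK (-k) x)
    (G' := fun x => (pd2 f x : ℂ) * eK (-k) x - Complex.I * k.2 * ((f x : ℂ) * eK (-k) x))
    (fun x y => by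
      refine ((hf.hasDerivAt_snd x y).ofReal_comp.mul (hasDerivAt_eK_snd (-k) x y)).congr_deriv ?_
      simp only [Prod.snd_neg, Int.cast_neg]; ring)
    (by fun_prop)
    (fun x => by
      have := hp.2 (x, 0)
      simp only [zero_add] at this
      simp only [eK_two_pi_snd, this])
  rw [integral_sub (integrableOn_Q2 (by fun_prop)) (integrableOn_Q2 (by fun_prop)),
    integral_const_mul, sub_eq_zero] at h0
  rw [fc_eq, fc_eq, h0]; ring

theorem conj_fc (f : ℝ × ℝ → ℝ) (k : ℤ × ℤ) : (starRingEnd ℂ) (fc f k) = fc f (-k) := by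
  rw [fc_eq, fc_eq, map_mul, ← integral_conj]
  simp [conj_eK, Complex.conj_ofNat]

theorem norm_fc_le (f : ℝ × ℝ → ℝ) (k : ℤ × ℤ) :
    ‖fc f k‖ ≤ ‖(1 / (2 * π) ^ 2 : ℂ)‖ * ∫ x in Q2, |f x| := by
  rw [fc_eq, norm_mul]
  gcongr
  refine (norm_integral_le_integral_norm _).trans_eq ?_
  simp [norm_eK]

theorem exists_fc_decay {f : ℝ × ℝ → ℝ} (hf : Smooth f) (hp : Per f) :
    ∃ B, ∀ k : ℤ × ℤ, ‖fc f k‖ ≤ B * (1 + (k.1 : ℝ) ^ 2)⁻¹ := by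
  refine ⟨‖(1 / (2 * π) ^ 2 : ℂ)‖ * (∫ x in Q2, |f x|) +
    ‖(1 / (2 * π) ^ 2 : ℂ)‖ * ∫ x in Q2, |pd1 (pd1 f) x|, fun k => ?_⟩
  have h : ((1 + (k.1 : ℝ) ^ 2 : ℝ) : ℂ) * fc f k = fc f k - fc (pd1 (pd1 f)) k := by
    rw [fc_pd1 hf.pd1 (hp.fderiv _), fc_pd1 hf hp]
    push_cast
    linear_combination ((k.1 : ℂ) ^ 2 * fc f k) * Complex.I_sq
  have hpos : (0 : ℝ) < 1 + (k.1 : ℝ) ^ 2 := by positivity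
  rw [← div_eq_mul_inv, le_div_iff₀ hpos, mul_comm]
  calc (1 + (k.1 : ℝ) ^ 2) * ‖fc f k‖ = ‖fc f k - fc (pd1 (pd1 f)) k‖ := by
        rw [← h, norm_mul, Complex.norm_real, Real.norm_of_nonneg hpos.le]
    _ ≤ _ := (norm_sub_le _ _).trans (add_le_add (norm_fc_le _ _) (norm_fc_le _ _))

/-- The vertical Fourier multiplier with symbol `m`. -/
def vmult (m : ℝ → ℝ) (f : ℝ × ℝ → ℝ) : ℝ × ℝ → ℂ :=
  fun x => ∑' k : ℤ × ℤ, (m k.2 : ℂ) * fc f k * eK k x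

/-- An even symbol vanishing at high frequencies. -/
structure IsCutoff (m : ℝ → ℝ) : Prop where
  even : ∀ z, m (-z) = m z
  vanish : ∃ R, ∀ z, R < |z| → m z = 0

theorem finite_support_of_isCutoff {m : ℝ → ℝ} (hm : IsCutoff m) :
    (Function.support fun n : ℤ => m n).Finite := by
  obtain ⟨R, hR⟩ := hm.vanish
  refine (Set.finite_Icc (-⌈R⌉) ⌈R⌉).subset fun n hn => ?_
  have h : |(n : ℝ)| ≤ R := not_lt.1 fun h => hn (hR _ h)
  have h' : (|n| : ℤ) ≤ ⌈R⌉ := by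
    exact_mod_cast (h.trans (Int.le_ceil R))
  exact abs_le.1 h'

theorem summable_vmult_coeff {m : ℝ → ℝ} (hm : IsCutoff m) {f : ℝ × ℝ → ℝ} (hf : Smooth f)
    (hp : Per f) : Summable fun k : ℤ × ℤ => ‖(m k.2 : ℂ) * fc f k‖ := by
  obtain ⟨B, hB⟩ := exists_fc_decay hf hp
  have h1 : Summable fun n : ℤ => B * (1 + (n : ℝ) ^ 2)⁻¹ := by
    refine Summable.mul_left _ ?_
    refine Summable.of_nonneg_of_le (fun n => by positivity) (fun n => ?_)
      ((Real.summable_one_div_int_pow (p := 2)).2 (by norm_num)|>.add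
        (summable_of_hasFiniteSupport
          (f := fun n : ℤ => if n = 0 then (1 : ℝ) else 0)
          ((Set.finite_singleton 0).subset fun n hn => by
            by_contra h; exact hn (if_neg h))))
    by_cases hn : n = 0
    · simp [hn]
    · have : (0 : ℝ) < (n : ℝ) ^ 2 := by positivity
      simp only [hn, if_false, add_zero, one_div]
      gcongr; linarith
  have h2 : Summable fun n : ℤ => |m n| :=
    summable_of_hasFiniteSupport ((finite_support_of_isCutoff hm).subset fun n hn => by
      simpa using hn)
  have hB0 : 0 ≤ B := by
    simpa using (norm_nonneg _).trans (hB 0)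
  refine Summable.of_nonneg_of_le (fun k => norm_nonneg _) (fun k => ?_)
    (h1.mul_of_nonneg h2 (fun n => by positivity) (fun n => abs_nonneg _))
  rw [norm_mul, Complex.norm_real, Real.norm_eq_abs, mul_comm]
  gcongr
  exact hB k

theorem continuous_vmult {m : ℝ → ℝ} (hm : IsCutoff m) {f : ℝ × ℝ → ℝ} (hf : Smooth f)
    (hp : Per f) : Continuous (vmult m f) :=
  continuous_tsum (fun k => continuous_const.mul (continuous_eK k)) (summable_vmult_coeff hm hf hp)
    fun k x => by rw [norm_mul, norm_eK, mul_one]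

theorem hasDerivAt_vmult {m : ℝ → ℝ} (hm : IsCutoff m) {f : ℝ × ℝ → ℝ} (hf : Smooth f)
    (hp : Per f) (x y : ℝ) :
    HasDerivAt (fun s => vmult m f (x, s)) (vmult m (pd2 f) (x, y)) y := by
  refine hasDerivAt_tsum (summable_vmult_coeff hm hf.pd2 (hp.fderiv _))
    (g' := fun k s => (m k.2 : ℂ) * fc (pd2 f) k * eK k (x, s)) (fun k s => ?_)
    (fun k s => by rw [norm_mul, norm_eK, mul_one]) (y₀ := 0) ?_ y
  · refine ((hasDerivAt_eK_snd k x s).const_mul ((m k.2 : ℂ) * fc f k)).congr_deriv ?_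
    rw [fc_pd2 hf hp]; ring
  · refine Summable.of_norm ?_
    simpa only [norm_mul, norm_eK, mul_one] using summable_vmult_coeff hm hf hp

theorem conj_vmult {m : ℝ → ℝ} (hm : IsCutoff m) (f : ℝ × ℝ → ℝ) (x : ℝ × ℝ) :
    (starRingEnd ℂ) (vmult m f x) = vmult m f x := by
  unfold vmult
  rw [Complex.conj_tsum, ← (Equiv.neg (ℤ × ℤ)).tsum_eq]
  refine tsum_congr fun k => ?_
  simp [conj_fc, conj_eK, hm.even]

theorem vmult_two_pi (m : ℝ → ℝ) (f : ℝ × ℝ → ℝ) (x : ℝ) :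
    vmult m f (x, 2 * π) = vmult m f (x, 0) := by
  simp only [vmult, eK_two_pi_snd]

theorem vmult_neg (m : ℝ → ℝ) (f : ℝ × ℝ → ℝ) (x : ℝ × ℝ) :
    vmult m (fun x => -f x) x = -vmult m f x := by
  unfold vmult
  rw [← tsum_neg]
  refine tsum_congr fun k => ?_
  simp [fc_eq, integral_neg]

theorem isCutoff_blockSymb {χ θ : ℝ → ℝ} (hp : IsDyadicPartition χ θ) (j : ℤ) :
    IsCutoff (blockSymb χ θ j) := by
  refine ⟨fun z => by simp [blockSymb], ?_⟩
  obtain ⟨R, -, hR⟩ := hp.chi_support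
  obtain ⟨r, R', -, -, hR'⟩ := hp.theta_support
  refine ⟨max R (2 ^ j * R'), fun z hz => ?_⟩
  have h1 := (le_max_left _ _).trans_lt hz
  have h2 := (le_max_right _ _).trans_lt hz
  have h2j : (0 : ℝ) < 2 ^ j := by positivity
  have hχ : χ |z| = 0 := hR _ (by rw [abs_abs]; exact h1.le)
  have hθ : θ ((2 : ℝ) ^ (-j) * |z|) = 0 := by
    refine hR' _ (Or.inr ?_)
    rw [abs_mul, abs_abs, abs_of_pos (by positivity), zpow_neg, ← div_eq_inv_mul, lt_div_iff₀ h2j,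
      mul_comm]
    exact h2
  simp only [blockSymb, hχ, hθ, ite_self]

theorem isCutoff_lowSymb {χ θ : ℝ → ℝ} (hp : IsDyadicPartition χ θ) (j : ℤ) :
    IsCutoff (lowSymb χ θ j) := by
  refine ⟨fun z => by simp only [lowSymb, (isCutoff_blockSymb hp _).even], ?_⟩
  choose R hR using fun j => (isCutoff_blockSymb hp j).vanish
  refine ⟨∑ i ∈ Finset.Icc (-1 : ℤ) (j - 2), |R i|, fun z hz => ?_⟩
  refine Finset.sum_eq_zero fun i hi => hR i z ?_
  exact ((le_abs_self _).trans
    (Finset.single_le_sum (f := fun i => |R i|) (fun i _ => abs_nonneg _) hi)).trans_lt hz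

theorem integrableOn_I2pi {f : ℝ → ℝ} (hf : Continuous f) : IntegrableOn f I2pi :=
  (hf.continuousOn.integrableOn_compact isCompact_Icc).mono_set Ioc_subset_Icc_self

theorem continuous_integral_I2pi {f : ℝ × ℝ → ℝ} (hf : Continuous f) :
    Continuous fun y => ∫ x in I2pi, f (x, y) := by
  simp only [I2pi, ← intervalIntegral.integral_of_le (show 0 ≤ 2 * π by positivity)]
  exact intervalIntegral.continuous_parametric_intervalIntegral_of_continuous'
    (f := fun y x => f (x, y)) (by fun_prop) _ _

theorem integral_mul_le_sqrt_mul_sqrt {f g : ℝ → ℝ} (hf : Continuous f) (hg : Continuous g)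
    (hf0 : ∀ x, 0 ≤ f x) (hg0 : ∀ x, 0 ≤ g x) :
    ∫ x in I2pi, f x * g x ≤
      √(∫ x in I2pi, f x ^ 2) * √(∫ x in I2pi, g x ^ 2) := by
  have hL : ∀ {h : ℝ → ℝ}, Continuous h →
      MemLp h (ENNReal.ofReal 2) (volume.restrict I2pi) := fun {h} hh => by
    rw [ENNReal.ofReal_ofNat, memLp_two_iff_integrable_sq hh.aestronglyMeasurable]
    exact integrableOn_I2pi (hh.pow 2)
  have := integral_mul_le_Lp_mul_Lq_of_nonneg Real.HolderConjugate.two_two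
    (ae_of_all _ hf0) (ae_of_all _ hg0) (hL hf) (hL hg)
  simpa only [Real.rpow_two, ← Real.sqrt_eq_rpow] using this

theorem integral_Q2_norm_mul_sq_le {E F : Type*} [NormedAddCommGroup E] [NormedAddCommGroup F]
    {b : ℝ × ℝ → E} {v : ℝ × ℝ → F} (hb : Continuous b) (hv : Continuous v) :
    ∫ x in Q2, ‖b x‖ * ‖v x‖ ^ 2 ≤ LinfvL2h b * L2vL4h v ^ 2 := by
  have hN : Continuous fun y => √(∫ x in I2pi, ‖b (x, y)‖ ^ 2) :=
    (continuous_integral_I2pi (f := fun z => ‖b z‖ ^ 2) (by fun_prop)).sqrt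
  have hV : Continuous fun y => √(∫ x in I2pi, ‖v (x, y)‖ ^ 4) :=
    (continuous_integral_I2pi (f := fun z => ‖v z‖ ^ 4) (by fun_prop)).sqrt
  have hbdd : ∀ᵐ y ∂volume.restrict I2pi, √(∫ x in I2pi, ‖b (x, y)‖ ^ 2) ≤ LinfvL2h b := by
    refine ae_le_essSup ?_
    obtain ⟨M, hM⟩ := (isCompact_Icc (a := (0 : ℝ)) (b := 2 * π)).bddAbove_image hN.continuousOn
    refine ⟨M, eventually_map.2 ((ae_restrict_iff' measurableSet_Ioc).2 (ae_of_all _ ?_))⟩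
    exact fun y hy => hM (mem_image_of_mem _ (Ioc_subset_Icc_self hy))
  rw [setIntegral_Q2_swap (by fun_prop), L2vL4h,
    Real.sq_sqrt (integral_nonneg fun y => Real.sqrt_nonneg _), ← integral_const_mul]
  refine integral_mono_ae
    (integrableOn_I2pi (continuous_integral_I2pi (f := fun z => ‖b z‖ * ‖v z‖ ^ 2) (by fun_prop)))
    (integrableOn_I2pi (continuous_const.mul hV)) ?_
  filter_upwards [hbdd] with y hy
  refine (integral_mul_le_sqrt_mul_sqrt (f := fun x => ‖b (x, y)‖) (g := fun x => ‖v (x, y)‖ ^ 2)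
    (by fun_prop) (by fun_prop) (fun x => norm_nonneg _) (fun x => by positivity)).trans ?_
  simp only [← pow_mul]
  gcongr

theorem ipCV_transport_eq {m n : ℝ → ℝ} (hm : IsCutoff m) (hn : IsCutoff n)
    {a f g : ℝ × ℝ → ℝ} (ha : Smooth a) (ha' : Per a) (hf : Smooth f) (hf' : Per f)
    (hg : Smooth g) (hg' : Per g) :
    ipCV (fun x => vmult m a x • (vmult n (pd2 f) x, vmult n (pd2 g) x))
        (fun x => (vmult n f x, vmult n g x)) =
      -(1 / 2) * ∫ x in Q2, vmult m (pd2 a) x * (vmult n f x ^ 2 + vmult n g x ^ 2) := by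
  have ca := continuous_vmult hm ha ha'
  have ca2 := continuous_vmult hm ha.pd2 (ha'.fderiv _)
  have cf := continuous_vmult hn hf hf'
  have cf2 := continuous_vmult hn hf.pd2 (hf'.fderiv _)
  have cg := continuous_vmult hn hg hg'
  have cg2 := continuous_vmult hn hg.pd2 (hg'.fderiv _)
  have h0 := integral_Q2_deriv_snd_eq_zero
    (G := fun x => vmult m a x * (vmult n f x ^ 2 + vmult n g x ^ 2))
    (G' := fun x => vmult m (pd2 a) x * (vmult n f x ^ 2 + vmult n g x ^ 2) +
      2 * (vmult m a x * (vmult n (pd2 f) x * vmult n f x + vmult n (pd2 g) x * vmult n g x)))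
    (fun x y => by
      refine ((hasDerivAt_vmult hm ha ha' x y).mul
        (((hasDerivAt_vmult hn hf hf' x y).pow 2).add
          ((hasDerivAt_vmult hn hg hg' x y).pow 2))).congr_deriv ?_
      simp only [Pi.add_apply, Pi.pow_apply]; push_cast; ring)
    (by fun_prop) (fun x => by simp only [vmult_two_pi])
  rw [integral_add (integrableOn_Q2 (by fun_prop)) (integrableOn_Q2 (by fun_prop)),
    integral_const_mul] at h0
  have h1 : ipCV (fun x => vmult m a x • (vmult n (pd2 f) x, vmult n (pd2 g) x))
      (fun x => (vmult n f x, vmult n g x)) = ∫ x in Q2, vmult m a x *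
        (vmult n (pd2 f) x * vmult n f x + vmult n (pd2 g) x * vmult n g x) := by
    unfold ipCV
    congr 1
    ext x
    simp only [conj_vmult hn, Prod.smul_mk, smul_eq_mul]
    ring
  rw [h1]
  linear_combination (1 / 2) * h0

/-- `|⟨S^v_{k−1}u² · Δ^v_k∂₂w, Δ^v_k w⟩| ≤ C ‖S^v_{k−1}∂₁u¹‖_{L^∞_v(L²_h)} ‖Δ^v_k w‖²_{L²_v(L⁴_h)}`. -/
theorem Sv_transport_estimate (χ θ : ℝ → ℝ) (hp : IsDyadicPartition χ θ) :
    ∃ C > 0, ∀ u w : ℝ × ℝ → ℝ × ℝ, SmoothV u → PerV u → DivFree u →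
      SmoothV w → PerV w →
      ∀ k : ℤ, -1 ≤ k →
      ‖ipCV (fun x => Sv χ θ (k - 1) (comp2 u) x • LPV χ θ k (pd2V w) x)
          (LPV χ θ k w)‖ ≤
        C * LinfvL2h (Sv χ θ (k - 1) (pd1 (comp1 u))) * L2vL4h (LPV χ θ k w) ^ 2 := by
  refine ⟨1, one_pos, fun u w hu hu' hdiv hw hw' k _ => ?_⟩
  have hm := isCutoff_lowSymb hp (k - 1)
  have hn := isCutoff_blockSymb hp k
  have su1 : Smooth (comp1 u) := contDiff_fst.comp hu
  have su2 : Smooth (comp2 u) := contDiff_snd.comp hu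
  have sw1 : Smooth (comp1 w) := contDiff_fst.comp hw
  have sw2 : Smooth (comp2 w) := contDiff_snd.comp hw
  have hdiv' : pd2 (comp2 u) = fun x => -pd1 (comp1 u) x := by
    ext x; linear_combination hdiv x
  set b := Sv χ θ (k - 1) (pd1 (comp1 u)) with hb
  set v := LPV χ θ k w with hv
  have cb : Continuous b := continuous_vmult hm su1.pd1 (hu'.1.fderiv _)
  have cv : Continuous v :=
    (continuous_vmult hn sw1 hw'.1).prodMk (continuous_vmult hn sw2 hw'.2)
  have key : ipCV (fun x => Sv χ θ (k - 1) (comp2 u) x • LPV χ θ k (pd2V w) x) v =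
      (1 / 2) * ∫ x in Q2, b x * ((v x).1 ^ 2 + (v x).2 ^ 2) := by
    refine (ipCV_transport_eq hm hn su2 hu'.2 sw1 hw'.1 sw2 hw'.2).trans ?_
    simp only [hdiv', vmult_neg, neg_mul, integral_neg, mul_neg, neg_neg]
    rfl
  rw [key, norm_mul, one_mul]
  refine le_trans ?_ (integral_Q2_norm_mul_sq_le cb cv)
  have hle : ‖∫ x in Q2, b x * ((v x).1 ^ 2 + (v x).2 ^ 2)‖ ≤
      ∫ x in Q2, 2 * (‖b x‖ * ‖v x‖ ^ 2) := by
    refine norm_integral_le_of_norm_le (integrableOn_Q2 (by fun_prop)) (ae_of_all _ fun x => ?_)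
    have h1 : ‖(v x).1‖ ^ 2 ≤ ‖v x‖ ^ 2 := by gcongr; exact norm_fst_le _
    have h2 : ‖(v x).2‖ ^ 2 ≤ ‖v x‖ ^ 2 := by gcongr; exact norm_snd_le _
    have h3 : ‖(v x).1 ^ 2 + (v x).2 ^ 2‖ ≤ 2 * ‖v x‖ ^ 2 := by
      refine (norm_add_le _ _).trans ?_
      rw [norm_pow, norm_pow]; linarith
    rw [norm_mul]
    calc ‖b x‖ * ‖(v x).1 ^ 2 + (v x).2 ^ 2‖ ≤ ‖b x‖ * (2 * ‖v x‖ ^ 2) := by gcongr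
      _ = _ := by ring
  rw [integral_const_mul] at hle
  norm_num
  linarith

end Aniso
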